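/- Let A ⊆ B be a (φ,ψ)-bounded extension of the multi-filtered K-algebra A. Then ⋃_{α∈ℕ^n} F̃_α(B) = B; more precisely, every product a_1 x_{i_1} a_2 x_{i_2} ⋯ x_{i_t} a_{t+1} with a_j ∈ F_{μ_j}(A) lies in F̃_{φ(μ_1+⋯+μ_{t+1}) + ψ(ε_{i_1}+⋯+ε_{i_t})}(B). -/

import Mathlib

open scoped BigOperators

/-- Multi-indices: elements of `ℕ^n`. -/
abbrev MIdx (n : ℕ) := Fin n → ℕ

/-- An admissible order on `ℕ^n`: a total order compatible with addition and having `0` as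
least element. -/
structure AdmOrder (n : ℕ) where
  le : MIdx n → MIdx n → Prop
  le_refl : ∀ a, le a a
  le_trans : ∀ {a b c}, le a b → le b c → le a c
  le_antisymm : ∀ {a b}, le a b → le b a → a = b
  le_total : ∀ a b, le a b ∨ le b a
  add_right : ∀ {a b : MIdx n} (c : MIdx n), le a b → le (a + c) (b + c)
  zero_le : ∀ a, le 0 a

/-- The strict order associated to an admissible order. -/
def AdmOrder.lt {n : ℕ} (o : AdmOrder n) (a b : MIdx n) : Prop :=
  o.le a b ∧ a ≠ b

/-- The ordered standard monomial `x^β = x₁^{β₁} ⋯ x_s^{β_s}`. -/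
def smon {B : Type*} [Monoid B] {s : ℕ} (x : Fin s → B) (β : MIdx s) : B :=
  (List.ofFn fun i => x i ^ β i).prod

/-- The `K`-submodule `Σ_{γ with P γ} F_{γ₁}(A)·x^{γ₂}` of `B`. -/
def monSum (K : Type*) [CommRing K] (B : Type*) [Ring B] [Algebra K B]
    {m s : ℕ} (F : MIdx m → Submodule K B) (x : Fin s → B)
    (P : MIdx m × MIdx s → Prop) : Submodule K B :=
  ⨆ γ ∈ {γ : MIdx m × MIdx s | P γ},
    (F γ.1).map (LinearMap.mulRight K (smon x γ.2))

/-- A `(φ,ψ)`-bounded extension `A ⊆ B` of a multi-filtered `K`-algebra `A`, where `A` is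
realized as a subalgebra of `B` carrying an `(ℕ^m,⪯₁)`-filtration `F`, and `B` is generated
over `A` by elements `x 1, …, x s`, subject to the axioms (EA1)–(EA4). -/
structure BoundedExt (K : Type*) [CommRing K] (B : Type*) [Ring B] [Algebra K B]
    (m s n : ℕ) where
  /-- admissible order `⪯₁` on `ℕ^m` -/
  o1 : AdmOrder m
  /-- admissible order `⪯₂` on `ℕ^s` -/
  o2 : AdmOrder s
  /-- admissible order `⪯` on `ℕ^n` -/
  o : AdmOrder n
  /-- the monoid morphism `φ : ℕ^m → ℕ^n` -/
  φ : MIdx m →+ MIdx n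
  /-- the monoid morphism `ψ : ℕ^s → ℕ^n` -/
  ψ : MIdx s →+ MIdx n
  φ_mono : ∀ {a b : MIdx m}, o1.le a b → o.le (φ a) (φ b)
  ψ_mono : ∀ {a b : MIdx s}, o2.le a b → o.le (ψ a) (ψ b)
  /-- the subalgebra `A` of `B` -/
  A : Subalgebra K B
  /-- (EA1): the `(ℕ^m,⪯₁)`-filtration on `A` -/
  F : MIdx m → Submodule K B
  F_le_A : ∀ a : MIdx m, F a ≤ Subalgebra.toSubmodule A
  F_mono : ∀ {a b : MIdx m}, o1.le a b → F a ≤ F b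
  F_mul : ∀ {a b : MIdx m} {u v : B}, u ∈ F a → v ∈ F b → u * v ∈ F (a + b)
  F_exhaustive : ∀ u ∈ A, ∃ a : MIdx m, u ∈ F a
  F_one : (1 : B) ∈ F 0
  /-- the generators `x_1, …, x_s` -/
  x : Fin s → B
  /-- (EA2): `B` is generated as a `K`-algebra by `A` and `x_1, …, x_s` -/
  gen : Algebra.adjoin K ((A : Set B) ∪ Set.range x) = ⊤
  /-- (EA3) -/
  EA3 : ∀ (i : Fin s) (α : MIdx m), ∀ a ∈ F α,
    x i * a ∈ (F α).map (LinearMap.mulRight K (x i)) ⊔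
      monSum K B F x (fun γ => o.lt (φ γ.1 + ψ γ.2) (φ α + ψ (Pi.single i 1)))
  /-- (EA4) -/
  EA4 : ∀ i j : Fin s, i < j → ∃ q ∈ F 0,
    x j * x i - q * (x i * x j) ∈
      monSum K B F x (fun γ => o.lt (φ γ.1 + ψ γ.2) (ψ (Pi.single i 1 + Pi.single j 1)))

namespace BoundedExt

variable {K : Type*} [CommRing K] {B : Type*} [Ring B] [Algebra K B] {m s n : ℕ}

/-- The weight `wt(γ) = φ(γ₁) + ψ(γ₂)` of a pair of multi-indices. -/
def wt (E : BoundedExt K B m s n) (γ : MIdx m × MIdx s) : MIdx n :=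
  E.φ γ.1 + E.ψ γ.2

/-- The filtration `F̃_α(B) = Σ_{wt(γ) ⪯ α} F_{γ₁}(A)x^{γ₂}` on `B`. -/
def tF (E : BoundedExt K B m s n) (α : MIdx n) : Submodule K B :=
  monSum K B E.F E.x (fun γ => E.o.le (E.wt γ) α)

/-- `F̃_{≺α}(B) = ⋃_{β ≺ α} F̃_β(B)`. -/
def tFlt (E : BoundedExt K B m s n) (α : MIdx n) : Submodule K B :=
  ⨆ β ∈ {β : MIdx n | E.o.lt β α}, E.tF β

/-- `F_{≺α}(A) = ⋃_{β ≺₁ α} F_β(A)`. -/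
def Flt (E : BoundedExt K B m s n) (α : MIdx m) : Submodule K B :=
  ⨆ β ∈ {β : MIdx m | E.o1.lt β α}, E.F β

/-- The strict order `≺'` on `ℕ^s × ℕ^n`: `(λ,ν) ≺' (λ',ν')` iff `ν ≺ ν'`, or `ν = ν'`
and `λ ≺₂ λ'`. -/
def ltP (E : BoundedExt K B m s n) (p q : MIdx s × MIdx n) : Prop :=
  E.o.lt p.2 q.2 ∨ (p.2 = q.2 ∧ E.o2.lt p.1 q.1)

end BoundedExt

namespace AdmOrder

variable {n : ℕ} (o : AdmOrder n)

theorem le_of_pi_le {a b : MIdx n} (h : a ≤ b) : o.le a b := by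
  have := o.add_right a (o.zero_le (b - a))
  rwa [zero_add, tsub_add_cancel_of_le h] at this

/-- Dickson's lemma: admissible orders are well-founded. -/
theorem wellFounded_lt : WellFounded o.lt := by
  rw [wellFounded_iff_isEmpty_descending_chain]
  refine ⟨fun ⟨f, hf⟩ => ?_⟩
  have anti : ∀ k d, o.lt (f (k + 1 + d)) (f k) := by
    intro k d
    induction d with
    | zero => exact hf k
    | succ d ih =>
      refine ⟨o.le_trans (hf _).1 ih.1, fun h => ?_⟩
      exact (hf (k + 1 + d)).2 (o.le_antisymm (hf _).1 (h ▸ ih.1 :))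
  obtain ⟨k, l, hkl, hle⟩ := wellQuasiOrdered_le f
  obtain ⟨d, rfl⟩ := Nat.exists_eq_add_of_lt hkl
  have := anti k d
  rw [show k + 1 + d = k + d + 1 by omega] at this
  exact this.2 (o.le_antisymm this.1 (o.le_of_pi_le hle))

theorem add_left {a b : MIdx n} (c : MIdx n) (h : o.le a b) : o.le (c + a) (c + b) := by
  simpa only [add_comm c] using o.add_right c h

theorem add_le_add {a b c d : MIdx n} (h : o.le a b) (h' : o.le c d) :
    o.le (a + c) (b + d) :=
  o.le_trans (o.add_right c h) (o.add_left b h')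

theorem add_lt_right {a b : MIdx n} (c : MIdx n) (h : o.lt a b) : o.lt (a + c) (b + c) :=
  ⟨o.add_right c h.1, fun e => h.2 (add_right_cancel e)⟩

theorem add_lt_left {a b : MIdx n} (c : MIdx n) (h : o.lt a b) : o.lt (c + a) (c + b) :=
  ⟨o.add_left c h.1, fun e => h.2 (add_left_cancel e)⟩

end AdmOrder

section StandardMonomials

variable {s : ℕ}

/-- The sorted list of letters of the standard monomial `x^γ`. -/
def stdList (γ : MIdx s) : List (Fin s) :=
  (List.finRange s).flatMap fun i => List.replicate (γ i) i

theorem prod_map_stdList {B : Type*} [Monoid B] (x : Fin s → B) (γ : MIdx s) :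
    ((stdList γ).map x).prod = smon x γ := by
  simp [stdList, smon, List.flatMap, List.prod_flatten, List.ofFn_eq_map,
    Function.comp_def]

theorem pairwise_stdList (γ : MIdx s) : (stdList γ).Pairwise (· ≤ ·) := by
  rw [stdList, List.pairwise_flatMap]
  refine ⟨fun i _ => by simp [List.pairwise_replicate], ?_⟩
  refine (List.pairwise_lt_finRange s).imp fun {i j} hij a ha b hb => ?_
  rw [List.eq_of_mem_replicate ha, List.eq_of_mem_replicate hb]
  exact hij.le

theorem count_stdList (γ : MIdx s) (i : Fin s) : (stdList γ).count i = γ i := by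
  simp only [stdList, List.count_flatMap, Function.comp_def, List.count_replicate]
  rw [← List.ofFn_eq_map, List.sum_ofFn]
  simp

theorem stdList_count_of_pairwise {l : List (Fin s)} (h : l.Pairwise (· ≤ ·)) :
    stdList (fun i => l.count i) = l :=
  List.Perm.eq_of_pairwise (fun _ _ _ _ => le_antisymm) (pairwise_stdList _) h
    (List.perm_iff_count.2 fun i => count_stdList _ i)

theorem sum_map_single_stdList (γ : MIdx s) :
    ((stdList γ).map fun i => (Pi.single i 1 : MIdx s)).sum = γ := by
  have key : ∀ l : List (Fin s),
      (l.map fun i => (Pi.single i 1 : MIdx s)).sum = fun i => l.count i := by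
    intro l
    induction l with
    | nil => rfl
    | cons i l ih =>
      ext j
      rw [List.map_cons, List.sum_cons, ih, Pi.add_apply, List.count_cons, add_comm]
      simp [Pi.single_apply, eq_comm (a := j)]
  rw [key]
  exact funext (count_stdList γ)

end StandardMonomials

theorem mul_smon_mem_monSum {K : Type*} [CommRing K] {B : Type*} [Ring B] [Algebra K B]
    {m s : ℕ} (F : MIdx m → Submodule K B) (x : Fin s → B) {P : MIdx m × MIdx s → Prop}
    {γ : MIdx m × MIdx s} (hγ : P γ) {a : B} (ha : a ∈ F γ.1) :
    a * smon x γ.2 ∈ monSum K B F x P :=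
  Submodule.mem_iSup_of_mem γ (Submodule.mem_iSup_of_mem hγ ⟨a, ha, rfl⟩)

theorem monSum_le_iff {K : Type*} [CommRing K] {B : Type*} [Ring B] [Algebra K B]
    {m s : ℕ} {F : MIdx m → Submodule K B} {x : Fin s → B} {P : MIdx m × MIdx s → Prop}
    {N : Submodule K B} :
    monSum K B F x P ≤ N ↔ ∀ γ, P γ → ∀ a ∈ F γ.1, a * smon x γ.2 ∈ N := by
  refine ⟨fun h γ hγ a ha => h (mul_smon_mem_monSum F x hγ ha), fun h => ?_⟩
  refine iSup₂_le fun γ hγ => ?_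
  rintro _ ⟨a, ha, rfl⟩
  exact h γ hγ a ha

namespace BoundedExt

variable {K : Type*} [CommRing K] {B : Type*} [Ring B] [Algebra K B] {m s n : ℕ}
  (E : BoundedExt K B m s n)

/-- `E.IsWord w u` says that `u` is a product of elements of the `F_μ(A)` and of generators
`x_i`, of total weight `w`. -/
inductive IsWord : MIdx n → B → Prop
  | one : IsWord 0 1
  | coeff {w : MIdx n} {u : B} {μ : MIdx m} {b : B} (hb : b ∈ E.F μ) (hu : IsWord w u) :
      IsWord (E.φ μ + w) (b * u)
  | gen {w : MIdx n} {u : B} (i : Fin s) (hu : IsWord w u) :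
      IsWord (E.ψ (Pi.single i 1) + w) (E.x i * u)

/-- The weight of the word `x_{i_1} ⋯ x_{i_t}`. -/
def listWt (l : List (Fin s)) : MIdx n :=
  E.ψ ((l.map fun i => (Pi.single i 1 : MIdx s)).sum)

/-- The word `x_{i_1} ⋯ x_{i_t}`. -/
def listProd (l : List (Fin s)) : B := (l.map E.x).prod

/-- The span of the words whose weight satisfies `P`. -/
def wordSpan (P : MIdx n → Prop) : Submodule K B :=
  Submodule.span K {u | ∃ v, P v ∧ E.IsWord v u}

variable {E}

@[simp] theorem listWt_nil : E.listWt [] = 0 := by simp [listWt]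

@[simp] theorem listWt_cons (i : Fin s) (l : List (Fin s)) :
    E.listWt (i :: l) = E.ψ (Pi.single i 1) + E.listWt l := by simp [listWt]

theorem listWt_stdList (γ : MIdx s) : E.listWt (stdList γ) = E.ψ γ := by
  rw [listWt, sum_map_single_stdList]

theorem listWt_perm {l l' : List (Fin s)} (h : l.Perm l') : E.listWt l = E.listWt l' := by
  rw [listWt, listWt, (h.map _).sum_eq]

@[simp] theorem listProd_nil : E.listProd [] = 1 := by simp [listProd]

@[simp] theorem listProd_cons (i : Fin s) (l : List (Fin s)) :
    E.listProd (i :: l) = E.x i * E.listProd l := by simp [listProd]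

theorem listProd_stdList (γ : MIdx s) : E.listProd (stdList γ) = smon E.x γ :=
  prod_map_stdList _ _

theorem IsWord.mul {v w : MIdx n} {u u' : B} (h : E.IsWord v u) (h' : E.IsWord w u') :
    E.IsWord (v + w) (u * u') := by
  induction h with
  | one => simpa using h'
  | coeff hb _ ih => simpa only [add_assoc, mul_assoc] using ih.coeff hb
  | gen i _ ih => simpa only [add_assoc, mul_assoc] using ih.gen i

theorem isWord_of_mem {μ : MIdx m} {b : B} (hb : b ∈ E.F μ) : E.IsWord (E.φ μ) b := by
  simpa using IsWord.one.coeff hb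

theorem isWord_of_mem_zero {b : B} (hb : b ∈ E.F 0) : E.IsWord 0 b := by
  simpa using isWord_of_mem hb

theorem isWord_x (i : Fin s) : E.IsWord (E.ψ (Pi.single i 1)) (E.x i) := by
  simpa using IsWord.one.gen (E := E) i

theorem isWord_listProd (l : List (Fin s)) : E.IsWord (E.listWt l) (E.listProd l) := by
  induction l with
  | nil => simpa using IsWord.one
  | cons i l ih => simpa using ih.gen i

theorem isWord_mul_smon {γ : MIdx m × MIdx s} {a : B} (ha : a ∈ E.F γ.1) :
    E.IsWord (E.wt γ) (a * smon E.x γ.2) := by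
  rw [← listProd_stdList, wt, ← listWt_stdList]
  exact (isWord_listProd _).coeff ha

theorem IsWord.mem_wordSpan {P : MIdx n → Prop} {w : MIdx n} {u : B} (h : E.IsWord w u)
    (hw : P w) : u ∈ E.wordSpan P :=
  Submodule.subset_span ⟨w, hw, h⟩

theorem mul_mem_wordSpan {P Q R : MIdx n → Prop} (hPQ : ∀ v w, P v → Q w → R (v + w))
    {u u' : B} (hu : u ∈ E.wordSpan P) (hu' : u' ∈ E.wordSpan Q) :
    u * u' ∈ E.wordSpan R := by
  have key : E.wordSpan P * E.wordSpan Q ≤ E.wordSpan R := by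
    rw [wordSpan, wordSpan, Submodule.span_mul_span, Submodule.span_le]
    rintro _ ⟨u, ⟨v, hv, h⟩, u', ⟨w, hw, h'⟩, rfl⟩
    exact (h.mul h').mem_wordSpan (hPQ v w hv hw)
  exact key (Submodule.mul_mem_mul hu hu')

theorem mul_word_mem_wordSpan_lt {v w : MIdx n} {u u' : B}
    (hu : u ∈ E.wordSpan (E.o.lt · v)) (hu' : E.IsWord w u') :
    u * u' ∈ E.wordSpan (E.o.lt · (v + w)) :=
  mul_mem_wordSpan (Q := (· = w)) (fun _ _ hv hw => hw ▸ E.o.add_lt_right _ hv) hu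
    (hu'.mem_wordSpan rfl)

theorem word_mul_mem_wordSpan_lt {v w : MIdx n} {u u' : B} (hu' : E.IsWord w u')
    (hu : u ∈ E.wordSpan (E.o.lt · v)) :
    u' * u ∈ E.wordSpan (E.o.lt · (w + v)) :=
  mul_mem_wordSpan (P := (· = w)) (fun _ _ hw hv => hw ▸ E.o.add_lt_left _ hv)
    (hu'.mem_wordSpan rfl) hu

theorem monSum_le_wordSpan (P : MIdx n → Prop) :
    monSum K B E.F E.x (fun γ => P (E.φ γ.1 + E.ψ γ.2)) ≤ E.wordSpan P :=
  monSum_le_iff.2 fun _ hγ _ ha => (isWord_mul_smon ha).mem_wordSpan hγ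

theorem exists_x_mul_sub_mem (i : Fin s) {α : MIdx m} {a : B} (ha : a ∈ E.F α) :
    ∃ a' ∈ E.F α, E.x i * a - a' * E.x i ∈
      E.wordSpan (E.o.lt · (E.ψ (Pi.single i 1) + E.φ α)) := by
  obtain ⟨_, ⟨a', ha', rfl⟩, z, hz, h⟩ := Submodule.mem_sup.1 (E.EA3 i α a ha)
  refine ⟨a', ha', ?_⟩
  rw [← h, LinearMap.mulRight_apply, add_sub_cancel_left, add_comm]
  exact monSum_le_wordSpan (E.o.lt · _) hz

theorem exists_x_mul_x_sub_mem {i j : Fin s} (hij : i < j) :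
    ∃ q ∈ E.F 0, E.x j * E.x i - q * (E.x i * E.x j) ∈
      E.wordSpan (E.o.lt · (E.ψ (Pi.single j 1) + E.ψ (Pi.single i 1))) := by
  obtain ⟨q, hq, h⟩ := E.EA4 i j hij
  refine ⟨q, hq, ?_⟩
  rw [← map_add, add_comm]
  exact monSum_le_wordSpan (E.o.lt · _) h

theorem mul_mem_F_zero {q q' : B} (hq : q ∈ E.F 0) (hq' : q' ∈ E.F 0) : q * q' ∈ E.F 0 := by
  simpa using E.F_mul hq hq'

theorem IsWord.exists_sub_mem {w : MIdx n} {u : B} (h : E.IsWord w u) :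
    ∃ (l : List (Fin s)) (ν : MIdx m), w = E.φ ν + E.listWt l ∧
      ∃ a ∈ E.F ν, u - a * E.listProd l ∈ E.wordSpan (E.o.lt · w) := by
  induction h with
  | one => exact ⟨[], 0, by simp, 1, E.F_one, by simp⟩
  | @coeff w u μ b hb _ ih =>
    obtain ⟨l, ν, rfl, a, ha, h⟩ := ih
    refine ⟨l, μ + ν, by rw [map_add, add_assoc], b * a, E.F_mul hb ha, ?_⟩
    rw [mul_assoc, ← mul_sub]
    exact word_mul_mem_wordSpan_lt (isWord_of_mem hb) h
  | @gen w u i _ ih =>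
    obtain ⟨l, ν, rfl, a, ha, h⟩ := ih
    obtain ⟨a', ha', h'⟩ := exists_x_mul_sub_mem i ha
    refine ⟨i :: l, ν, by rw [listWt_cons]; abel, a', ha', ?_⟩
    have h₁ := word_mul_mem_wordSpan_lt (isWord_x i) h
    have h₂ := mul_word_mem_wordSpan_lt h' (isWord_listProd l)
    rw [add_assoc] at h₂
    convert add_mem h₁ h₂ using 1
    rw [listProd_cons]
    noncomm_ring

theorem exists_x_mul_listProd_sub_mem (i : Fin s) (l : List (Fin s)) :
    ∃ q ∈ E.F 0, E.x i * E.listProd l - q * E.listProd (l.orderedInsert (· ≤ ·) i) ∈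
      E.wordSpan (E.o.lt · (E.listWt (i :: l))) := by
  induction l with
  | nil => exact ⟨1, E.F_one, by simp⟩
  | cons h t ih =>
    by_cases hi : i ≤ h
    · exact ⟨1, E.F_one, by simp [List.orderedInsert, hi]⟩
    obtain ⟨q, hq, hs⟩ := exists_x_mul_x_sub_mem (E := E) (not_le.1 hi)
    obtain ⟨q', hq', ht⟩ := ih
    obtain ⟨q'', hq'', hp⟩ := exists_x_mul_sub_mem h hq'
    refine ⟨q * q'', mul_mem_F_zero hq hq'', ?_⟩
    have hins : E.listWt (t.orderedInsert (· ≤ ·) i) = E.listWt (i :: t) :=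
      listWt_perm (List.perm_orderedInsert _ i t)
    have h₁ := mul_word_mem_wordSpan_lt hs (isWord_listProd t)
    have h₂ := word_mul_mem_wordSpan_lt ((isWord_x h).coeff hq) ht
    have h₃ := word_mul_mem_wordSpan_lt (isWord_of_mem hq)
      (mul_word_mem_wordSpan_lt hp (isWord_listProd (t.orderedInsert (· ≤ ·) i)))
    rw [hins] at h₃
    simp only [listWt_cons, map_zero, zero_add, add_zero] at h₁ h₂ h₃ ⊢
    rw [add_assoc] at h₁
    rw [add_left_comm] at h₂ h₃
    convert add_mem (add_mem h₁ h₂) h₃ using 1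
    simp only [List.orderedInsert, hi, if_false, listProd_cons]
    noncomm_ring

theorem exists_listProd_sub_insertionSort_mem (l : List (Fin s)) :
    ∃ q ∈ E.F 0, E.listProd l - q * E.listProd (l.insertionSort (· ≤ ·)) ∈
      E.wordSpan (E.o.lt · (E.listWt l)) := by
  induction l with
  | nil => exact ⟨1, E.F_one, by simp⟩
  | cons i l ih =>
    obtain ⟨q, hq, h⟩ := ih
    obtain ⟨q', hq', h'⟩ := exists_x_mul_sub_mem i hq
    obtain ⟨r, hr, h''⟩ := exists_x_mul_listProd_sub_mem (E := E) i (l.insertionSort (· ≤ ·))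
    refine ⟨q' * r, mul_mem_F_zero hq' hr, ?_⟩
    have hsort : E.listWt (l.insertionSort (· ≤ ·)) = E.listWt l :=
      listWt_perm (List.perm_insertionSort _ l)
    have h₁ := word_mul_mem_wordSpan_lt (isWord_x i) h
    have h₂ := mul_word_mem_wordSpan_lt h' (isWord_listProd (l.insertionSort (· ≤ ·)))
    have h₃ := word_mul_mem_wordSpan_lt (isWord_of_mem hq') h''
    simp only [listWt_cons, map_zero, zero_add, add_zero, hsort] at h₁ h₂ h₃ ⊢
    convert add_mem (add_mem h₁ h₂) h₃ using 1
    simp only [List.insertionSort_cons, listProd_cons]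
    noncomm_ring

theorem tF_mono {α β : MIdx n} (h : E.o.le α β) : E.tF α ≤ E.tF β :=
  monSum_le_iff.2 fun _ hγ _ ha =>
    mul_smon_mem_monSum E.F E.x (P := fun γ => E.o.le (E.wt γ) β) (E.o.le_trans hγ h) ha

theorem IsWord.mem_tF {w : MIdx n} {u : B} (h : E.IsWord w u) : u ∈ E.tF w := by
  induction w using E.o.wellFounded_lt.induction generalizing u with
  | _ w ih =>
    have hlow : E.wordSpan (E.o.lt · w) ≤ E.tF w := by
      refine Submodule.span_le.2 ?_
      rintro u ⟨v, hv, hu⟩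
      exact tF_mono hv.1 (ih v hv hu)
    obtain ⟨l, ν, rfl, a, ha, hu⟩ := h.exists_sub_mem
    obtain ⟨q, hq, hl⟩ := exists_listProd_sub_insertionSort_mem (E := E) l
    have hl' := word_mul_mem_wordSpan_lt (isWord_of_mem ha) hl
    set γ : MIdx s := fun i => (l.insertionSort (· ≤ ·)).count i with hγ
    have hstd : stdList γ = l.insertionSort (· ≤ ·) :=
      stdList_count_of_pairwise (List.pairwise_insertionSort _ l)
    have hwt : E.wt (ν, γ) = E.φ ν + E.listWt l := by
      rw [wt, ← listWt_stdList, hstd, listWt_perm (List.perm_insertionSort _ l)]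
    have haq : a * q ∈ E.F ν := by simpa using E.F_mul ha hq
    have hmain : a * q * smon E.x γ ∈ E.tF (E.φ ν + E.listWt l) :=
      mul_smon_mem_monSum E.F E.x (γ := (ν, γ))
        (P := fun γ => E.o.le (E.wt γ) (E.φ ν + E.listWt l)) (hwt ▸ E.o.le_refl _) haq
    rw [← listProd_stdList, hstd] at hmain
    convert add_mem (add_mem (hlow hu) (hlow hl')) hmain using 1
    noncomm_ring

theorem tF_eq_wordSpan (α : MIdx n) : E.tF α = E.wordSpan (E.o.le · α) := by
  refine le_antisymm (monSum_le_wordSpan (E.o.le · α)) (Submodule.span_le.2 ?_)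
  rintro u ⟨v, hv, hu⟩
  exact tF_mono hv hu.mem_tF

theorem mul_mem_tF {α β : MIdx n} {u v : B} (hu : u ∈ E.tF α) (hv : v ∈ E.tF β) :
    u * v ∈ E.tF (α + β) := by
  rw [tF_eq_wordSpan] at hu hv ⊢
  have key : ∀ v w, E.o.le v α → E.o.le w β → E.o.le (v + w) (α + β) :=
    fun v w hv hw => E.o.add_le_add hv hw
  exact mul_mem_wordSpan (P := (E.o.le · α)) (Q := (E.o.le · β))
    (R := (E.o.le · (α + β))) key hu hv

theorem exists_mem_tF (b : B) : ∃ α : MIdx n, b ∈ E.tF α := by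
  have hb : b ∈ Algebra.adjoin K ((E.A : Set B) ∪ Set.range E.x) := E.gen ▸ Algebra.mem_top
  induction hb using Algebra.adjoin_induction with
  | mem u hu =>
    rcases hu with hu | ⟨i, rfl⟩
    · obtain ⟨μ, hμ⟩ := E.F_exhaustive u hu
      exact ⟨_, (isWord_of_mem hμ).mem_tF⟩
    · exact ⟨_, (isWord_x i).mem_tF⟩
  | algebraMap r =>
    rw [Algebra.algebraMap_eq_smul_one]
    exact ⟨0, Submodule.smul_mem _ _ IsWord.one.mem_tF⟩
  | add u v _ _ hu hv =>
    obtain ⟨α, hα⟩ := hu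
    obtain ⟨β, hβ⟩ := hv
    rcases E.o.le_total α β with h | h
    · exact ⟨β, add_mem (tF_mono h hα) hβ⟩
    · exact ⟨α, add_mem hα (tF_mono h hβ)⟩
  | mul u v _ _ hu hv =>
    obtain ⟨α, hα⟩ := hu
    obtain ⟨β, hβ⟩ := hv
    exact ⟨α + β, mul_mem_tF hα hβ⟩

theorem isWord_ofFn (t : ℕ) (i : Fin t → Fin s) (μ : Fin (t + 1) → MIdx m)
    (a : Fin (t + 1) → B) (ha : ∀ j, a j ∈ E.F (μ j)) :
    E.IsWord (E.φ (∑ j, μ j) + E.ψ (∑ k, Pi.single (i k) 1))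
      ((List.ofFn fun k : Fin t => a k.castSucc * E.x (i k)).prod * a (Fin.last t)) := by
  induction t with
  | zero => simpa using isWord_of_mem (ha 0)
  | succ t ih =>
    have := ((ih (fun k => i k.succ) (fun j => μ j.succ) (fun j => a j.succ)
      fun j => ha j.succ).gen (i 0)).coeff (ha 0)
    convert this using 1
    · rw [Fin.sum_univ_succ μ, Fin.sum_univ_succ (fun k => (Pi.single (i k) 1 : MIdx s)),
        map_add, map_add]
      abel
    · simp [List.ofFn_succ, mul_assoc]

end BoundedExt

/-- For a `(φ,ψ)`-bounded extension `A ⊆ B` one has `⋃_{α ∈ ℕ^n} F̃_α(B) = B`; more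
precisely, every product `a_1 x_{i_1} a_2 x_{i_2} ⋯ x_{i_t} a_{t+1}` with `a_j ∈ F_{μ_j}(A)`
lies in `F̃_{φ(μ_1+⋯+μ_{t+1}) + ψ(ε_{i_1}+⋯+ε_{i_t})}(B)`. -/
theorem boundedExt_tF_exhaustive {K : Type*} [CommRing K] {B : Type*} [Ring B]
    [Algebra K B] {m s n : ℕ} (E : BoundedExt K B m s n) :
    (∀ b : B, ∃ α : MIdx n, b ∈ E.tF α) ∧
    (∀ (t : ℕ) (i : Fin t → Fin s) (μ : Fin (t + 1) → MIdx m) (a : Fin (t + 1) → B),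
      (∀ j, a j ∈ E.F (μ j)) →
      (List.ofFn fun k : Fin t => a k.castSucc * E.x (i k)).prod * a (Fin.last t) ∈
        E.tF (E.φ (∑ j, μ j) + E.ψ (∑ k, Pi.single (i k) 1))) := by
  exact ⟨BoundedExt.exists_mem_tF, fun t i μ a ha => (BoundedExt.isWord_ofFn t i μ a ha).mem_tF⟩
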